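/- For any resolvent R(z) = (L_H − z)⁻¹ of a Liouvillian L_H (a derivation with respect to a Poisson bracket), and any element F, the following identity holds for z₁, z₂, z₃ in the resolvent set: R(z₁) L_F R(z₃) = L_{R(z₂)F} R(z₃) − R(z₁) L_{R(z₂)F} + (z₁ − z₂ − z₃) R(z₁) L_{R(z₂)F} R(z₃). -/

import Mathlib

/-- The 'integration by parts' identity for the Liouvillian resolvent.
Let `ℒ : A →ₗ Module.End A` assign to each element its Liouville operator,
satisfying the commutator identity `ℒ_F ℒ_G − ℒ_G ℒ_F = ℒ_{ℒ_F G}`, and let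
`R z` be a two-sided inverse of `ℒ_H − z` for `z ∈ {z₁, z₂, z₃}`.  Then
`R(z₁) ℒ_F R(z₃) = ℒ_{R(z₂)F} R(z₃) − R(z₁) ℒ_{R(z₂)F}
  + (z₁ − z₂ − z₃) R(z₁) ℒ_{R(z₂)F} R(z₃)`. -/
theorem liouvillian_resolvent_integration_by_parts
    {A : Type*} [AddCommGroup A] [Module ℂ A]
    (ℒ : A →ₗ[ℂ] Module.End ℂ A)
    (hJac : ∀ F G : A, ℒ F * ℒ G - ℒ G * ℒ F = ℒ ((ℒ F) G))
    (H : A) (R : ℂ → Module.End ℂ A) (z₁ z₂ z₃ : ℂ)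
    (hR : ∀ z ∈ ({z₁, z₂, z₃} : Set ℂ),
      (ℒ H - z • (1 : Module.End ℂ A)) * R z = 1 ∧
      R z * (ℒ H - z • (1 : Module.End ℂ A)) = 1)
    (F : A) :
    R z₁ * ℒ F * R z₃
      = ℒ (R z₂ F) * R z₃ - R z₁ * ℒ (R z₂ F)
        + (z₁ - z₂ - z₃) • (R z₁ * ℒ (R z₂ F) * R z₃) := by
  have h₁ : R z₁ * ℒ H = 1 + z₁ • R z₁ := by
    have h := (hR z₁ (by simp)).2
    rwa [mul_sub, mul_smul_comm, mul_one, sub_eq_iff_eq_add] at h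
  have h₃ : ℒ H * R z₃ = 1 + z₃ • R z₃ := by
    have h := (hR z₃ (by simp)).1
    rwa [sub_mul, smul_mul_assoc, one_mul, sub_eq_iff_eq_add] at h
  have hF : ℒ F = ℒ H * ℒ (R z₂ F) - ℒ (R z₂ F) * ℒ H - z₂ • ℒ (R z₂ F) := by
    have h : ℒ H (R z₂ F) - z₂ • R z₂ F = F :=
      LinearMap.congr_fun (hR z₂ (by simp)).1 F
    rw [hJac, ← map_smul, ← map_sub, h]
  rw [hF]
  generalize ℒ (R z₂ F) = G
  calc R z₁ * (ℒ H * G - G * ℒ H - z₂ • G) * R z₃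
      = (R z₁ * ℒ H) * G * R z₃ - R z₁ * G * (ℒ H * R z₃)
          - z₂ • (R z₁ * G * R z₃) := by
        simp only [mul_sub, sub_mul, mul_smul_comm, smul_mul_assoc, mul_assoc]
    _ = G * R z₃ - R z₁ * G + (z₁ - z₂ - z₃) • (R z₁ * G * R z₃) := by
        rw [h₁, h₃]
        simp only [add_mul, mul_add, one_mul, mul_one, smul_mul_assoc, mul_smul_comm]
        module
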